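/- arXiv:2210.10970 — 8 statements merged into one kernel-verified Lean document; each statement's English description precedes it below -/
import Mathlib

section
/- Under the stated federated learning setup, suppose the global loss F is L-smooth, bounded below by F⋆, each sample-wise gradient satisfies ‖∇f_{k,i}(w)‖² ≤ κ for all w, and the learning rate satisfies 0 < η ≤ 1/L. Let a : Fin N → Fin K → {0,1} be a device-scheduling assignment with at least one device scheduled in every round, and define iterates by w_{n+1} = w_n − η · (Σ_k a_n(k) D_k ∇F_k(w_n)) / (Σ_k a_n(k) D_k). Then (1/N) Σ_{n=0}^{N−1} ‖∇F(w_n)‖² ≤ (2/(Nη)) (F(w_0) − F⋆) + (4Kκ/(N D²)) Σ_{n=0}^{N−1} Σ_{k=1}^{K} (1 − a_n(k)) D_k². -/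
open scoped RealInnerProductSpace BigOperators

theorem aux_grad {E : Type*} [NormedAddCommGroup E] [InnerProductSpace ℝ E] [CompleteSpace E]
    {ι : Type*} [Fintype ι] (c : ℝ) (d : ι → ℝ) (g : ι → E → ℝ) (g' : ι → E) (H : E → ℝ) (h : E)
    (w : E) (hH : ∀ w, H w = c * ∑ i, d i * g i w) (hg : ∀ i, HasGradientAt (g i) (g' i) w)
    (hh : HasGradientAt H h w) : h = c • ∑ i, d i • g' i := by
  refine hh.unique ?_
  rw [hasGradientAt_iff_hasFDerivAt]
  have h1 : HasFDerivAt (fun w => c * ∑ i, d i * g i w)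
      (c • ∑ i, d i • (InnerProductSpace.toDual ℝ E) (g' i)) w := by
    refine HasFDerivAt.const_mul (HasFDerivAt.fun_sum fun i _ => ?_) c
    exact HasFDerivAt.const_mul (hg i).hasFDerivAt (d i)
  rw [← funext hH] at h1
  simpa [map_sum] using h1

theorem aux_norm {E : Type*} [NormedAddCommGroup E] [InnerProductSpace ℝ E]
    {ι : Type*} [Fintype ι] (d : ι → ℝ) (hd : ∀ i, 0 ≤ d i) (g : ι → E) (r : ℝ)
    (hg : ∀ i, ‖g i‖ ≤ r) : ‖∑ i, d i • g i‖ ≤ (∑ i, d i) * r := by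
  rw [Finset.sum_mul]
  refine norm_sum_le_of_le _ fun i _ => ?_
  rw [norm_smul, Real.norm_of_nonneg (hd i)]
  exact mul_le_mul_of_nonneg_left (hg i) (hd i)

theorem aux_err {E : Type*} [NormedAddCommGroup E] [InnerProductSpace ℝ E]
    (K : ℕ) (d a : Fin K → ℝ) (hd : ∀ k, 0 < d k) (ha : ∀ k, a k = 0 ∨ a k = 1)
    (hs : ∃ k, a k = 1) (g : Fin K → E) (κ : ℝ) (hκ : 0 < κ) (hg : ∀ k, ‖g k‖ ≤ √κ) :
    ‖(∑ k, d k)⁻¹ • ∑ k, d k • g k - (∑ k, a k * d k)⁻¹ • ∑ k, (a k * d k) • g k‖ ^ 2 ≤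
      4 * K * κ / (∑ k, d k) ^ 2 * ∑ k, (1 - a k) * d k ^ 2 := by
  have ha0 : ∀ k, 0 ≤ a k * d k := fun k => by
    rcases ha k with h | h <;> simp [h, (hd k).le]
  have hb0 : ∀ k, 0 ≤ (1 - a k) * d k := fun k => by
    rcases ha k with h | h <;> simp [h, (hd k).le]
  have hP := aux_norm _ ha0 g _ hg
  have hQ := aux_norm _ hb0 g _ hg
  have hS : 0 < ∑ k, a k * d k := by
    obtain ⟨k, hk⟩ := hs
    refine Finset.sum_pos' (fun k _ => ha0 k) ⟨k, Finset.mem_univ _, ?_⟩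
    simp [hk, hd k]
  have hU : 0 ≤ ∑ k, (1 - a k) * d k := Finset.sum_nonneg fun k _ => hb0 k
  have hDs : ∑ k, d k = ∑ k, a k * d k + ∑ k, (1 - a k) * d k := by
    rw [← Finset.sum_add_distrib]; exact Finset.sum_congr rfl fun k _ => by ring
  have hGs : ∑ k, d k • g k = ∑ k, (a k * d k) • g k + ∑ k, ((1 - a k) * d k) • g k := by
    rw [← Finset.sum_add_distrib]
    exact Finset.sum_congr rfl fun k _ => by rw [← add_smul]; congr 1; ring
  have hCS : (∑ k, (1 - a k) * d k) ^ 2 ≤ K * ∑ k, (1 - a k) * d k ^ 2 := by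
    have := sq_sum_le_card_mul_sum_sq (s := Finset.univ) (f := fun k => (1 - a k) * d k)
    simp only [Finset.card_univ, Fintype.card_fin] at this
    refine this.trans (le_of_eq ?_)
    congr 1
    refine Finset.sum_congr rfl fun k _ => ?_
    rcases ha k with h | h <;> simp [h]
  rw [hGs, hDs]
  generalize ∑ k, (a k * d k) • g k = P at *
  generalize ∑ k, ((1 - a k) * d k) • g k = Q at *
  generalize ∑ k, (1 - a k) * d k ^ 2 = V at *
  generalize ∑ k, a k * d k = S at *
  generalize ∑ k, (1 - a k) * d k = U at *
  have hD : 0 < S + U := by linarith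
  have e : (S + U)⁻¹ • (P + Q) - S⁻¹ • P = (S + U)⁻¹ • (Q - (U / S) • P) := by
    have h2 : S⁻¹ = (S + U)⁻¹ * (1 + U / S) := by field_simp
    rw [h2]; module
  have hb : ‖Q - (U / S) • P‖ ≤ 2 * U * √κ := by
    have h3 : ‖(U / S) • P‖ ≤ U * √κ := by
      rw [norm_smul, Real.norm_of_nonneg (by positivity)]
      calc U / S * ‖P‖ ≤ U / S * (S * √κ) := by gcongr
        _ = U * √κ := by field_simp
    linarith [norm_sub_le Q ((U / S) • P)]
  rw [e, norm_smul, mul_pow, Real.norm_of_nonneg (by positivity)]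
  calc (S + U)⁻¹ ^ 2 * ‖Q - (U / S) • P‖ ^ 2 ≤ (S + U)⁻¹ ^ 2 * (2 * U * √κ) ^ 2 := by gcongr
    _ = (S + U)⁻¹ ^ 2 * (4 * κ) * U ^ 2 := by
      rw [mul_pow, Real.sq_sqrt hκ.le]; ring
    _ ≤ (S + U)⁻¹ ^ 2 * (4 * κ) * (K * V) := by gcongr
    _ = _ := by field_simp

/-- Convergence bound for federated learning with device scheduling
(Theorem 1 of the paper): under `L`-smoothness of the global loss `F`,
a lower bound `Fstar` on `F`, a uniform bound `κ` on the squared norms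
of the sample-wise gradients, and learning rate `0 < η ≤ 1/L`, the
average squared norm of the global gradient along the scheduled-average
iterates is bounded by the initial optimality gap plus the scheduling
penalty. -/
theorem fl_convergence_bound
    {E : Type*} [NormedAddCommGroup E] [InnerProductSpace ℝ E] [CompleteSpace E]
    (K N : ℕ) (hK : 1 ≤ K) (hN : 1 ≤ N)
    (Dk : Fin K → ℕ) (hDk : ∀ k, 0 < Dk k)
    (D : ℝ) (hD : D = ∑ k, (Dk k : ℝ))
    (f : (k : Fin K) → Fin (Dk k) → E → ℝ)
    (gradf : (k : Fin K) → Fin (Dk k) → E → E)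
    (hgradf : ∀ k i w, HasGradientAt (f k i) (gradf k i w) w)
    (Fk : Fin K → E → ℝ)
    (hFk : ∀ k w, Fk k w = (Dk k : ℝ)⁻¹ * ∑ i, f k i w)
    (F : E → ℝ) (hF : ∀ w, F w = D⁻¹ * ∑ k, (Dk k : ℝ) * Fk k w)
    (gradFk : Fin K → E → E)
    (hgradFk : ∀ k w, HasGradientAt (Fk k) (gradFk k w) w)
    (gradF : E → E) (hgradF : ∀ w, HasGradientAt F (gradF w) w)
    (L : ℝ) (hL : 0 < L)
    (hsmooth : ∀ w w' : E,
      F w ≤ F w' + ⟪gradF w', w - w'⟫ + L / 2 * ‖w - w'‖ ^ 2)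
    (Fstar : ℝ) (hFstar : ∀ w, Fstar ≤ F w)
    (κ : ℝ) (hκ : 0 < κ)
    (hgradbound : ∀ k i w, ‖gradf k i w‖ ^ 2 ≤ κ)
    (η : ℝ) (hη : 0 < η) (hηL : η ≤ 1 / L)
    (a : Fin N → Fin K → ℝ) (ha : ∀ n k, a n k = 0 ∨ a n k = 1)
    (hsched : ∀ n, ∃ k, a n k = 1)
    (w : ℕ → E)
    (hupdate : ∀ n : Fin N,
      w (n.1 + 1) = w n.1 -
        η • ((∑ k, a n k * (Dk k : ℝ))⁻¹ •
          ∑ k, (a n k * (Dk k : ℝ)) • gradFk k (w n.1))) :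
    (N : ℝ)⁻¹ * ∑ n : Fin N, ‖gradF (w n.1)‖ ^ 2 ≤
      2 / (N * η) * (F (w 0) - Fstar) +
        4 * K * κ / (N * D ^ 2) *
          ∑ n : Fin N, ∑ k, (1 - a n k) * (Dk k : ℝ) ^ 2 := by
  have hd : ∀ k, (0:ℝ) < Dk k := fun k => by exact_mod_cast hDk k
  have hsq : ∀ k i w, ‖gradf k i w‖ ≤ √κ := fun k i w => Real.le_sqrt_of_sq_le (hgradbound k i w)
  have hgk : ∀ k w, ‖gradFk k w‖ ≤ √κ := fun k w => by
    have h1 := aux_grad (Dk k : ℝ)⁻¹ (fun _ => (1:ℝ)) (f k) (fun i => gradf k i w) (Fk k)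
      (gradFk k w) w (fun w => by simp [hFk]) (fun i => hgradf k i w) (hgradFk k w)
    have h2 := aux_norm (fun _ => (1:ℝ)) (fun _ => zero_le_one) (fun i => gradf k i w) _
      (fun i => hsq k i w)
    rw [h1, norm_smul, Real.norm_of_nonneg (by positivity)]
    have h3 : (∑ _i : Fin (Dk k), (1:ℝ)) = Dk k := by simp
    rw [h3] at h2
    have := hd k
    rw [inv_mul_le_iff₀ this]
    exact h2
  have hG : ∀ w, gradF w = D⁻¹ • ∑ k, (Dk k : ℝ) • gradFk k w := fun w =>
    aux_grad _ _ Fk (fun k => gradFk k w) F _ w hF (fun k => hgradFk k w) (hgradF w)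
  have step : ∀ n : Fin N, ‖gradF (w n.1)‖ ^ 2 ≤ 2 / η * (F (w n.1) - F (w (n.1 + 1))) +
      4 * K * κ / D ^ 2 * ∑ k, (1 - a n k) * (Dk k : ℝ) ^ 2 := fun n => by
    have he := aux_err K (fun k => (Dk k : ℝ)) (a n) hd (ha n) (hsched n)
      (fun k => gradFk k (w n.1)) κ hκ (fun k => hgk k _)
    rw [← hD, ← hG] at he
    have hs := hsmooth (w (n.1 + 1)) (w n.1)
    have hu := hupdate n
    generalize (∑ k, a n k * (Dk k : ℝ))⁻¹ • ∑ k, (a n k * (Dk k : ℝ)) • gradFk k (w n.1) = g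
      at he hu
    have hw : w (n.1 + 1) - w n.1 = -(η • g) := by rw [hu]; abel
    rw [hw, inner_neg_right, inner_smul_right, norm_neg, norm_smul,
      Real.norm_of_nonneg hη.le] at hs
    rw [norm_sub_sq_real] at he
    have hLη : L * η ≤ 1 := by rw [le_div_iff₀ hL] at hηL; linarith
    have h4 : L / 2 * (η * ‖g‖) ^ 2 ≤ η / 2 * ‖g‖ ^ 2 := by
      have : 0 ≤ η / 2 * ‖g‖ ^ 2 := by positivity
      nlinarith [mul_le_mul_of_nonneg_right hLη this]
    have h5 : 2 * ⟪gradF (w n.1), g⟫ - ‖g‖ ^ 2 ≤ 2 / η * (F (w n.1) - F (w (n.1 + 1))) := by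
      rw [div_mul_eq_mul_div, le_div_iff₀ hη]
      linarith
    linarith
  have hsum := Finset.sum_le_sum fun n (_ : n ∈ Finset.univ) => step n
  rw [Finset.sum_add_distrib, ← Finset.mul_sum, ← Finset.mul_sum,
    Fin.sum_univ_eq_sum_range (fun n => F (w n) - F (w (n + 1))),
    Finset.sum_range_sub' (fun n => F (w n))] at hsum
  have hN' : (0:ℝ) < N := by exact_mod_cast hN
  have hl : 2 / η * (F (w 0) - F (w N)) ≤ 2 / η * (F (w 0) - Fstar) := by
    have := hFstar (w N)
    gcongr
  calc _ ≤ (N : ℝ)⁻¹ * (2 / η * (F (w 0) - Fstar) +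
        4 * K * κ / D ^ 2 * ∑ n : Fin N, ∑ k, (1 - a n k) * (Dk k : ℝ) ^ 2) := by
        gcongr; linarith
    _ = _ := by
      rw [mul_add, ← mul_assoc, ← mul_assoc]
      congr 2
      · field_simp
      · rw [inv_mul_eq_div, div_div, mul_comm (D ^ 2)]
end

section
/- Let E be a real inner product space and F : E → ℝ be differentiable with gradient ∇F, satisfying the L-smoothness inequality F(w) ≤ F(w') + ⟨∇F(w'), w − w'⟩ + (L/2)‖w − w'‖² for all w, w' ∈ E. If 0 < η ≤ 1/L, then for any w ∈ E and any vector g ∈ E, setting w' = w − η g, one has ‖∇F(w)‖² ≤ (2/η) (F(w) − F(w')) + ‖∇F(w) − g‖². -/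
open scoped RealInnerProductSpace

/-- One-step descent inequality: if `F` is differentiable with gradient
`∇F` and `L`-smooth, and `0 < η ≤ 1/L`, then for any point `w` and any
update direction `g`, setting `w' = w - η • g`,
`‖∇F(w)‖² ≤ (2/η)(F(w) - F(w')) + ‖∇F(w) - g‖²`. -/
theorem descent_step_bound
    {E : Type*} [NormedAddCommGroup E] [InnerProductSpace ℝ E] [CompleteSpace E]
    (F : E → ℝ) (gradF : E → E)
    (hgradF : ∀ w, HasGradientAt F (gradF w) w)
    (L : ℝ) (hL : 0 < L)
    (hsmooth : ∀ w w' : E,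
      F w ≤ F w' + ⟪gradF w', w - w'⟫ + L / 2 * ‖w - w'‖ ^ 2)
    (η : ℝ) (hη : 0 < η) (hηL : η ≤ 1 / L)
    (w g : E) :
    ‖gradF w‖ ^ 2 ≤ 2 / η * (F w - F (w - η • g)) + ‖gradF w - g‖ ^ 2 := by
  have h := hsmooth (w - η • g) w
  have e : w - η • g - w = -(η • g) := by abel
  rw [e, inner_neg_right, real_inner_smul_right, norm_neg, norm_smul, Real.norm_eq_abs,
    mul_pow, sq_abs] at h
  have hLη : η * L ≤ 1 := (le_div_iff₀ hL).mp hηL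
  have h1 : η * L * ‖g‖ ^ 2 ≤ 1 * ‖g‖ ^ 2 := mul_le_mul_of_nonneg_right hLη (sq_nonneg _)
  have h2 : 2 * ⟪gradF w, g⟫ - η * L * ‖g‖ ^ 2 ≤ 2 / η * (F w - F (w - η • g)) := by
    rw [div_mul_eq_mul_div, le_div_iff₀ hη]
    nlinarith [h]
  rw [norm_sub_sq_real]
  linarith
end

section
/- Let E be a real inner product space, K ≥ 1, and for each k ∈ Fin K let D_k be a positive integer and v_{k,i} ∈ E (i ∈ Fin D_k) be vectors with ‖v_{k,i}‖² ≤ κ for some κ > 0. Set G_k = Σ_i v_{k,i} and D = Σ_k D_k. Let a_k ∈ {0,1} with Σ_k a_k D_k > 0. Then ‖(Σ_k a_k G_k)/(Σ_k a_k D_k) − (Σ_k G_k)/D‖² ≤ (4Kκ/D²) Σ_k (1 − a_k) D_k². -/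
open scoped BigOperators

/-- Bound on the deviation between the scheduled weighted average and the
full weighted average of per-device gradient sums (the key estimate in
the convergence analysis): with `G k = ∑ i, v k i`, `D = ∑ k, D_k`, and
binary scheduling weights `a k` with `∑ k, a k * D_k > 0`,
`‖(∑ a_k G_k)/(∑ a_k D_k) - (∑ G_k)/D‖² ≤ (4Kκ/D²) ∑ (1-a_k) D_k²`. -/
theorem scheduled_average_deviation_bound
    {E : Type*} [NormedAddCommGroup E] [InnerProductSpace ℝ E]
    (K : ℕ) (hK : 1 ≤ K)
    (Dk : Fin K → ℕ) (hDk : ∀ k, 0 < Dk k)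
    (v : (k : Fin K) → Fin (Dk k) → E)
    (κ : ℝ) (hκ : 0 < κ)
    (hv : ∀ k i, ‖v k i‖ ^ 2 ≤ κ)
    (G : Fin K → E) (hG : ∀ k, G k = ∑ i, v k i)
    (D : ℝ) (hD : D = ∑ k, (Dk k : ℝ))
    (a : Fin K → ℝ) (ha : ∀ k, a k = 0 ∨ a k = 1)
    (hapos : 0 < ∑ k, a k * (Dk k : ℝ)) :
    ‖(∑ k, a k * (Dk k : ℝ))⁻¹ • (∑ k, a k • G k) - D⁻¹ • ∑ k, G k‖ ^ 2 ≤
      4 * K * κ / D ^ 2 * ∑ k, (1 - a k) * (Dk k : ℝ) ^ 2 := by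
  set S := ∑ k, a k * (Dk k : ℝ) with hS
  set R := ∑ k, (1 - a k) * (Dk k : ℝ) with hR
  have hRS : D = S + R := by
    rw [hD, hS, hR, ← Finset.sum_add_distrib]
    exact Finset.sum_congr rfl fun k _ => by ring
  have hsplit : ∑ k, G k = ∑ k, a k • G k + ∑ k, (1 - a k) • G k := by
    rw [← Finset.sum_add_distrib]
    exact Finset.sum_congr rfl fun k _ => by rw [← add_smul]; simp
  have hvn : ∀ k i, ‖v k i‖ ≤ √κ := fun k i => Real.le_sqrt_of_sq_le (hv k i)
  have hGn : ∀ k, ‖G k‖ ≤ Dk k * √κ := fun k => by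
    rw [hG k]
    refine (norm_sum_le _ _).trans ((Finset.sum_le_sum fun i _ => hvn k i).trans ?_)
    simp
  have ha0 : ∀ k, 0 ≤ a k := fun k => by rcases ha k with h | h <;> simp [h]
  have ha1 : ∀ k, 0 ≤ 1 - a k := fun k => by rcases ha k with h | h <;> simp [h]
  have key : ∀ b : Fin K → ℝ, (∀ k, 0 ≤ b k) →
      ‖∑ k, b k • G k‖ ≤ (∑ k, b k * (Dk k : ℝ)) * √κ := fun b hb => by
    rw [Finset.sum_mul]
    refine (norm_sum_le _ _).trans (Finset.sum_le_sum fun k _ => ?_)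
    rw [norm_smul, Real.norm_of_nonneg (hb k), mul_assoc]
    exact mul_le_mul_of_nonneg_left (hGn k) (hb k)
  have hA := key a ha0
  have hB := key _ ha1
  rw [← hS] at hA
  rw [← hR] at hB
  have hR0 : 0 ≤ R := Finset.sum_nonneg fun k _ => mul_nonneg (ha1 k) (Nat.cast_nonneg _)
  have hDpos : 0 < D := by linarith
  have hcoef : S⁻¹ - D⁻¹ = R / (S * D) := by
    have := hapos.ne'
    have := hDpos.ne'
    field_simp
    linarith
  have hnorm : ‖S⁻¹ • (∑ k, a k • G k) - D⁻¹ • ∑ k, G k‖ ≤ 2 * R * √κ / D := by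
    have e : S⁻¹ • (∑ k, a k • G k) - D⁻¹ • ∑ k, G k
        = (R / (S * D)) • (∑ k, a k • G k) - D⁻¹ • ∑ k, (1 - a k) • G k := by
      rw [hsplit, ← hcoef, sub_smul, smul_add]; abel
    rw [e]
    refine (norm_sub_le _ _).trans ?_
    rw [norm_smul, norm_smul, Real.norm_of_nonneg (by positivity),
      Real.norm_of_nonneg (by positivity)]
    calc _ ≤ R / (S * D) * (S * √κ) + D⁻¹ * (R * √κ) := by gcongr
      _ = _ := by
        have := hapos.ne'
        have := hDpos.ne'
        field_simp
        ring
  have hCS : R ^ 2 ≤ K * ∑ k, (1 - a k) * (Dk k : ℝ) ^ 2 := by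
    have h := sq_sum_le_card_mul_sum_sq (s := Finset.univ)
      (f := fun k => (1 - a k) * (Dk k : ℝ))
    simp only [Finset.card_univ, Fintype.card_fin] at h
    refine h.trans (le_of_eq ?_)
    congr 1
    exact Finset.sum_congr rfl fun k _ => by rcases ha k with h | h <;> simp [h]
  calc _ ≤ (2 * R * √κ / D) ^ 2 := by gcongr
    _ = 4 * κ / D ^ 2 * R ^ 2 := by
      rw [div_pow, mul_pow, Real.sq_sqrt hκ.le]; ring
    _ ≤ 4 * κ / D ^ 2 * (K * ∑ k, (1 - a k) * (Dk k : ℝ) ^ 2) := by gcongr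
    _ = _ := by ring
end

section
/- For every real c ≥ 0, the function τ ↦ τ · (2^{c/τ} − 1) is antitone on (0, ∞): for all 0 < τ₁ ≤ τ₂, τ₂ · (2^{c/τ₂} − 1) ≤ τ₁ · (2^{c/τ₁} − 1). -/
/-- The transmission energy `τ · (2^{c/τ} - 1)` is non-increasing in the
transmission time `τ` on `(0, ∞)`. -/
theorem energy_antitone (c : ℝ) (hc : 0 ≤ c) :
    ∀ τ₁ τ₂ : ℝ, 0 < τ₁ → τ₁ ≤ τ₂ →
      τ₂ * ((2 : ℝ) ^ (c / τ₂) - 1) ≤ τ₁ * ((2 : ℝ) ^ (c / τ₁) - 1) := by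
  intro a b ha hab
  have hb : 0 < b := ha.trans_le hab
  have hpos : (0 : ℝ) < (2 : ℝ) ^ (c / b) := by positivity
  have hp : 1 ≤ b / a := (one_le_div ha).2 hab
  have h := one_add_mul_self_le_rpow_one_add
    (s := (2 : ℝ) ^ (c / b) - 1) (by linarith) hp
  have e : c / b * (b / a) = c / a := by field_simp
  rw [add_sub_cancel, ← Real.rpow_mul (by norm_num), e] at h
  have h2 : b / a * ((2 : ℝ) ^ (c / b) - 1) ≤ (2 : ℝ) ^ (c / a) - 1 := by linarith
  have h3 := mul_le_mul_of_nonneg_left h2 ha.le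
  rwa [← mul_assoc, mul_div_cancel₀ _ ha.ne'] at h3
end

section
/- For every real c, the function (a, τ) ↦ τ · (2^{c·a/τ} − 1) from ℝ × ℝ to ℝ is convex on the set {(a, τ) : τ > 0}; that is, ConvexOn ℝ {p : ℝ × ℝ | 0 < p.2} (fun p => p.2 * (2^{c * p.1 / p.2} − 1)). -/
/-- Joint convexity of the perspective-type communication-energy function
`(a, τ) ↦ τ · (2^{c·a/τ} - 1)` on the half-plane `{τ > 0}`. -/
theorem energy_convexOn (c : ℝ) :
    ConvexOn ℝ {p : ℝ × ℝ | 0 < p.2}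
      (fun p : ℝ × ℝ => p.2 * ((2 : ℝ) ^ (c * p.1 / p.2) - 1)) := by
  have hconv : Convex ℝ {p : ℝ × ℝ | 0 < p.2} :=
    convex_halfSpace_gt (LinearMap.snd ℝ ℝ ℝ).isLinear 0
  refine ⟨hconv, ?_⟩
  rintro ⟨x, s⟩ hs ⟨y, t⟩ ht a b ha hb hab
  have hT : 0 < a * s + b * t := hconv hs ht ha hb hab
  have hs' : 0 < s := hs
  have ht' : 0 < t := ht
  have h2 := (convexOn_rpow_left (b := 2) (by norm_num)).2 (Set.mem_univ (c * x / s))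
    (Set.mem_univ (c * y / t))
    (div_nonneg (mul_nonneg ha hs'.le) hT.le) (div_nonneg (mul_nonneg hb ht'.le) hT.le)
    (by rw [← add_div, div_self hT.ne'])
  simp only [smul_eq_mul, Prod.smul_mk, Prod.mk_add_mk] at h2 ⊢
  have e : a * s / (a * s + b * t) * (c * x / s) + b * t / (a * s + b * t) * (c * y / t)
      = c * (a * x + b * y) / (a * s + b * t) := by
    have := hs'.ne'
    have := ht'.ne'
    have := hT.ne'
    field_simp
  rw [e] at h2
  have h3 := mul_le_mul_of_nonneg_left h2 hT.le
  have e2 : ∀ u v : ℝ, (a * s + b * t) * (a * s / (a * s + b * t) * u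
      + b * t / (a * s + b * t) * v) = a * s * u + b * t * v := by
    intro u v
    have := hT.ne'
    field_simp
  rw [e2] at h3
  linarith
end

section
/- Let μ > 0, λ > 0, h > 0, σ² > 0 and c > 0 be reals, and define φ(τ) = μ τ + (λ σ²/h) · τ · (2^{c/τ} − 1) for τ > 0. Suppose W is a real number with W > −1 satisfying W · e^W = h μ/(e λ σ²) − 1/e (the principal branch of the Lambert W function evaluated at h μ/(e λ σ²) − 1/e). Then τ⋆ = c · ln 2 / (1 + W) satisfies τ⋆ > 0 and is a global minimizer of φ on (0, ∞): for every τ > 0, φ(τ⋆) ≤ φ(τ). -/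
/-- Closed-form optimal time allocation (Theorem 3 of the paper): with
dual prices `μ, λ`, channel gain `h`, noise power `σ²` and payload `c`,
the per-device Lagrangian cost `φ(τ) = μτ + (λσ²/h) τ (2^{c/τ} - 1)` is
globally minimized over `τ > 0` at `τ⋆ = c ln 2 / (1 + W)`, where `W` is
the principal Lambert-W value of `hμ/(eλσ²) - 1/e`. -/
theorem optimal_time_allocation
    (μ lam h σ2 c : ℝ) (hμ : 0 < μ) (hlam : 0 < lam) (hh : 0 < h)
    (hσ2 : 0 < σ2) (hc : 0 < c)
    (φ : ℝ → ℝ)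
    (hφ : ∀ τ : ℝ, 0 < τ →
      φ τ = μ * τ + lam * σ2 / h * (τ * ((2 : ℝ) ^ (c / τ) - 1)))
    (W : ℝ) (hW : -1 < W)
    (hWeq : W * Real.exp W = h * μ / (Real.exp 1 * lam * σ2) - 1 / Real.exp 1)
    (τstar : ℝ) (hτstar : τstar = c * Real.log 2 / (1 + W)) :
    0 < τstar ∧ ∀ τ : ℝ, 0 < τ → φ τstar ≤ φ τ := by
  have hu : 0 < 1 + W := by linarith
  have hL : 0 < c * Real.log 2 := mul_pos hc (Real.log_pos (by norm_num))
  have hts : 0 < τstar := by rw [hτstar]; exact div_pos hL hu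
  have hK : 0 < lam * σ2 / h := by positivity
  have he : 0 < Real.exp 1 := Real.exp_pos 1
  have hmu : μ = lam * σ2 / h * (1 + W * Real.exp (1 + W)) := by
    have h1 : W * Real.exp (1 + W) = h * μ / (lam * σ2) - 1 := by
      rw [Real.exp_add]
      calc W * (Real.exp 1 * Real.exp W) = Real.exp 1 * (W * Real.exp W) := by ring
        _ = _ := by rw [hWeq]; field_simp
    rw [h1]; field_simp; ring
  have key : ∀ τ : ℝ, 0 < τ → φ τ = lam * σ2 / h *
      (τ * (W * Real.exp (1 + W) + Real.exp (c * Real.log 2 / τ))) := by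
    intro τ hτ
    have h2 : (2 : ℝ) ^ (c / τ) = Real.exp (c * Real.log 2 / τ) := by
      rw [Real.rpow_def_of_pos (by norm_num)]; congr 1; ring
    have h3 : μ * τ = lam * σ2 / h * (1 + W * Real.exp (1 + W)) * τ := by rw [← hmu]
    rw [hφ τ hτ, h2, h3]; ring
  refine ⟨hts, fun τ hτ => ?_⟩
  rw [key _ hts, key _ hτ]
  refine mul_le_mul_of_nonneg_left ?_ hK.le
  have hx : c * Real.log 2 / τstar = 1 + W := by
    rw [hτstar]; field_simp
  have hprod : τstar * (1 + W) = c * Real.log 2 := by rw [hτstar]; field_simp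
  have hτx : τ * (c * Real.log 2 / τ) = c * Real.log 2 := by field_simp
  rw [hx]
  generalize c * Real.log 2 / τ = x at *
  have h4 : Real.exp (1 + W) * (x - (1 + W) + 1) ≤ Real.exp x := by
    have h5 := mul_le_mul_of_nonneg_left (Real.add_one_le_exp (x - (1 + W)))
      (Real.exp_pos (1 + W)).le
    rwa [← Real.exp_add, add_sub_cancel] at h5
  calc τstar * (W * Real.exp (1 + W) + Real.exp (1 + W))
      = (τstar * (1 + W)) * Real.exp (1 + W) := by ring
    _ = (τ * x) * Real.exp (1 + W) := by rw [hprod, hτx]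
    _ = τ * (W * Real.exp (1 + W) + Real.exp (1 + W) * (x - (1 + W) + 1)) := by ring
    _ ≤ _ := mul_le_mul_of_nonneg_left (by linarith) hτ.le
end

section
/- Let E be a real inner product space, let w_k ∈ E (k in a finite index type) be points, let c_k ≥ 0 be weights with Σ_k c_k > 0, let p ∈ E and r > 0. Set v = (Σ_k c_k • w_k) / (Σ_k c_k) − p and q⋆ = p + min(r/‖v‖, 1) • v (with the Lean convention r/0 = 0, so q⋆ = p when v = 0). Then q⋆ lies in the closed ball of radius r centered at p, and for every q in that closed ball, Σ_k c_k ‖q⋆ − w_k‖² ≤ Σ_k c_k ‖q − w_k‖². -/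
open scoped BigOperators

/-- Closed-form optimal UAV position update (Theorem 5 of the paper):
the weighted-sum-of-squared-distances objective `∑ k, c k ‖q - w k‖²` is
minimized over the closed displacement ball `‖q - p‖ ≤ r` at the
projection of the weighted centroid onto that ball, i.e. at
`q⋆ = p + min (r/‖v‖) 1 • v` with
`v = (∑ k, c k • w k)/(∑ k, c k) - p`. -/
theorem optimal_uav_position
    {E : Type*} [NormedAddCommGroup E] [InnerProductSpace ℝ E]
    {ι : Type*} [Fintype ι]
    (w : ι → E) (c : ι → ℝ) (hc : ∀ k, 0 ≤ c k) (hcpos : 0 < ∑ k, c k)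
    (p : E) (r : ℝ) (hr : 0 < r)
    (v : E) (hv : v = (∑ k, c k)⁻¹ • (∑ k, c k • w k) - p)
    (qstar : E) (hqstar : qstar = p + min (r / ‖v‖) 1 • v) :
    qstar ∈ Metric.closedBall p r ∧
      ∀ q ∈ Metric.closedBall p r,
        ∑ k, c k * ‖qstar - w k‖ ^ 2 ≤ ∑ k, c k * ‖q - w k‖ ^ 2 := by
  have key : ∀ d : E, ∑ k, c k * ‖p + d - w k‖ ^ 2
      = ∑ k, c k * ‖p - w k‖ ^ 2 + (∑ k, c k) * (‖d‖ ^ 2 - 2 * inner ℝ d v) := by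
    intro d
    have h1 : (∑ k, c k) • v = ∑ k, c k • (w k - p) := by
      rw [hv, smul_sub, smul_inv_smul₀ hcpos.ne']
      simp only [smul_sub, Finset.sum_sub_distrib, Finset.sum_smul]
    have h2 : (∑ k, c k) * inner ℝ d v = ∑ k, c k * inner ℝ d (w k - p) := by
      rw [← real_inner_smul_right, h1, inner_sum]
      simp only [real_inner_smul_right]
    have h3 : ∀ k, c k * ‖p + d - w k‖ ^ 2
        = c k * ‖p - w k‖ ^ 2 + c k * ‖d‖ ^ 2 - 2 * (c k * inner ℝ d (w k - p)) := by
      intro k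
      have e : p + d - w k = d - (w k - p) := by abel
      rw [e, norm_sub_sq_real, norm_sub_rev (w k) p]
      ring
    simp only [h3, Finset.sum_sub_distrib, Finset.sum_add_distrib, ← Finset.mul_sum,
      ← Finset.sum_mul]
    linear_combination 2 * h2
  have ht0 : 0 ≤ min (r / ‖v‖) 1 := le_min (by positivity) zero_le_one
  have hs : min (r / ‖v‖) 1 * ‖v‖ = min r ‖v‖ := by
    rcases (norm_nonneg v).eq_or_lt with h | h
    · rw [← h, mul_zero, min_eq_right hr.le]
    · rw [min_mul_of_nonneg _ _ h.le, div_mul_cancel₀ _ h.ne', one_mul]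
  generalize min (r / ‖v‖) 1 = t at *
  have hn : ‖t • v‖ = min r ‖v‖ := by
    rw [norm_smul, Real.norm_of_nonneg ht0, hs]
  subst hqstar
  refine ⟨?_, ?_⟩
  · rw [mem_closedBall_iff_norm, add_sub_cancel_left, hn]
    exact min_le_left _ _
  · intro q hq
    rw [mem_closedBall_iff_norm] at hq
    have hk := key (q - p)
    rw [add_sub_cancel] at hk
    rw [hk, key (t • v)]
    have hi := real_inner_le_norm (q - p) v
    have hin : inner ℝ (t • v) v = min r ‖v‖ * ‖v‖ := by
      rw [real_inner_smul_left, real_inner_self_eq_norm_sq, ← hs]; ring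
    rw [hin, hn]
    gcongr _ + _ * ?_
    rcases le_total r ‖v‖ with h | h
    · rw [min_eq_left h]
      nlinarith [mul_nonneg (sub_nonneg.2 hq) (sub_nonneg.2 h), sq_nonneg (r - ‖q - p‖)]
    · rw [min_eq_right h]
      nlinarith [sq_nonneg (‖q - p‖ - ‖v‖)]
end

section
/- Let K, N ≥ 1, and let s, B, σ², β₀, H be positive reals. For each device k ∈ Fin K and round n ∈ Fin N, let a_{k,n} ∈ {0,1}, τ_{k,n} > 0, and let the channel gain h_{k,n} > 0 satisfy h_{k,n} ≤ β₀/H². If for each k the total communication energy satisfies Σ_n (τ_{k,n} σ²/h_{k,n}) (2^{a_{k,n} s/(B τ_{k,n})} − 1) ≤ E_k, then Σ_k E_k ≥ (s σ² H² ln 2/(B β₀)) · Σ_k Σ_n a_{k,n}. -/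
open scoped BigOperators

/-- Necessary energy condition (part of Proposition 1 of the paper):
since the UAV flies at altitude `H`, each channel gain satisfies
`h ≤ β₀/H²`, so each scheduled upload of `s` bits costs at least
`s σ² H² ln 2 / (B β₀)`; hence the total energy budgets must cover
`(s σ² H² ln 2/(B β₀)) ∑_{k,n} a_{k,n}`. -/
theorem energy_budget_necessary_condition
    (K N : ℕ) (hK : 1 ≤ K) (hN : 1 ≤ N)
    (s B σ2 β0 H : ℝ) (hs : 0 < s) (hB : 0 < B) (hσ2 : 0 < σ2)
    (hβ0 : 0 < β0) (hH : 0 < H)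
    (a : Fin K → Fin N → ℝ) (ha : ∀ k n, a k n = 0 ∨ a k n = 1)
    (τ : Fin K → Fin N → ℝ) (hτ : ∀ k n, 0 < τ k n)
    (h : Fin K → Fin N → ℝ) (hhpos : ∀ k n, 0 < h k n)
    (hhle : ∀ k n, h k n ≤ β0 / H ^ 2)
    (Ek : Fin K → ℝ)
    (hE : ∀ k, ∑ n, τ k n * σ2 / h k n *
        ((2 : ℝ) ^ (a k n * s / (B * τ k n)) - 1) ≤ Ek k) :
    s * σ2 * H ^ 2 * Real.log 2 / (B * β0) * ∑ k, ∑ n, a k n ≤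
      ∑ k, Ek k := by
  rw [Finset.mul_sum]
  refine Finset.sum_le_sum fun k _ => le_trans ?_ (hE k)
  rw [Finset.mul_sum]
  refine Finset.sum_le_sum fun n _ => ?_
  have hl : 0 < Real.log 2 := Real.log_pos (by norm_num)
  have ht := hτ k n
  have hp := hhpos k n
  have ha0 : 0 ≤ a k n := by rcases ha k n with e | e <;> rw [e] <;> norm_num
  have h1 : Real.log 2 * (a k n * s / (B * τ k n)) ≤
      (2 : ℝ) ^ (a k n * s / (B * τ k n)) - 1 := by
    rw [Real.rpow_def_of_pos (by norm_num : (0 : ℝ) < 2)]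
    linarith [Real.add_one_le_exp (Real.log 2 * (a k n * s / (B * τ k n)))]
  have h2 : H ^ 2 / β0 ≤ 1 / h k n := by
    have h3 := hhle k n
    rw [le_div_iff₀ (by positivity)] at h3
    rw [div_le_div_iff₀ hβ0 hp]
    linarith
  calc s * σ2 * H ^ 2 * Real.log 2 / (B * β0) * a k n
      = (a k n * s * σ2 * Real.log 2 / B) * (H ^ 2 / β0) := by field_simp
    _ ≤ (a k n * s * σ2 * Real.log 2 / B) * (1 / h k n) :=
        mul_le_mul_of_nonneg_left h2 (by positivity)
    _ = τ k n * σ2 / h k n * (Real.log 2 * (a k n * s / (B * τ k n))) := by field_simp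
    _ ≤ _ := mul_le_mul_of_nonneg_left h1 (by positivity)
end
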